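/- arXiv:1805.04135 — 3 statements merged into one kernel-verified Lean document; each statement's English description precedes it below -/
import Mathlib

section
/- There exist constants c₀, c₁ > 0 such that for all s, r > 0 and all f ∈ C_c^∞(ℝ^d): ∫_{ℝ^d} f² dμ ≤ (s + c₁·Ψ₁(r))·D(f,f) + c₀·(1 + s^{-d/α})·( ∫_{{|x| ≤ r}} |f(x)| dx )². -/
open MeasureTheory

/-- The fractional Dirichlet energy
`D(f,f) = ∫∫ (f(x) − f(y))² / |x − y|^{d+α} dx dy` on `ℝ^d`. -/
noncomputable def fracD (d : ℕ) (α : ℝ) (f : EuclideanSpace ℝ (Fin d) → ℝ) : ℝ :=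
  ∫ x, ∫ y, (f x - f y) ^ 2 / ‖x - y‖ ^ ((d : ℝ) + α)

open scoped ENNReal

/-- The kernel of the energy, as an extended nonnegative real. -/
noncomputable def eK (d : ℕ) (α : ℝ) (f : EuclideanSpace ℝ (Fin d) → ℝ)
    (x y : EuclideanSpace ℝ (Fin d)) : ℝ≥0∞ :=
  ENNReal.ofReal ((f x - f y) ^ 2 / ‖x - y‖ ^ ((d : ℝ) + α))

/-- The energy, as an extended nonnegative real. -/
noncomputable def eD (d : ℕ) (α : ℝ) (f : EuclideanSpace ℝ (Fin d) → ℝ) : ℝ≥0∞ :=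
  ∫⁻ x, ∫⁻ y, eK d α f x y

lemma measurable_eK (d : ℕ) (α : ℝ) (f : EuclideanSpace ℝ (Fin d) → ℝ) (hf : Continuous f) :
    Measurable (Function.uncurry (eK d α f)) := by
  have := hf.measurable
  unfold eK Function.uncurry
  fun_prop

/-- pointwise bound of the increment by the kernel -/
lemma sq_le_eK (d : ℕ) (α : ℝ) (hp : 0 < (d : ℝ) + α) (f : EuclideanSpace ℝ (Fin d) → ℝ)
    (x y : EuclideanSpace ℝ (Fin d)) (t : ℝ) (h : ‖x - y‖ ≤ t) :
    ENNReal.ofReal ((f x - f y) ^ 2) ≤ ENNReal.ofReal (t ^ ((d : ℝ) + α)) * eK d α f x y := by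
  have ht : 0 ≤ t := (norm_nonneg _).trans h
  unfold eK
  rw [← ENNReal.ofReal_mul (by positivity)]
  apply ENNReal.ofReal_le_ofReal
  by_cases hxy : x = y
  · subst hxy; simp
  · have h0 : 0 < ‖x - y‖ := norm_pos_iff.2 (sub_ne_zero.2 hxy)
    have h1 : 0 < ‖x - y‖ ^ ((d : ℝ) + α) := Real.rpow_pos_of_pos h0 _
    have h2 : ‖x - y‖ ^ ((d : ℝ) + α) ≤ t ^ ((d : ℝ) + α) :=
      Real.rpow_le_rpow h0.le h hp.le
    rw [mul_div_assoc', le_div_iff₀ h1, mul_comm]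
    exact mul_le_mul_of_nonneg_right h2 (sq_nonneg _)

lemma local_sp (d : ℕ) (α : ℝ) (hp : 0 < (d : ℝ) + α) (f : EuclideanSpace ℝ (Fin d) → ℝ)
    (hf : Continuous f) (t r : ℝ) (ht : 0 < t) (htr : t ≤ r) :
    volume (Metric.closedBall (0 : EuclideanSpace ℝ (Fin d)) (t / 2)) *
      ∫⁻ x in Metric.closedBall 0 r, ENNReal.ofReal (f x ^ 2) ≤
      2 * (∫⁻ x in Metric.closedBall 0 r, ENNReal.ofReal |f x|) ^ 2 +
        ENNReal.ofReal (t ^ ((d : ℝ) + α)) * eD d α f := by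
  have hfm := hf.measurable
  have hK := measurable_eK d α f hf
  have hr : 0 < r := ht.trans_le htr
  set B := Metric.closedBall (0 : EuclideanSpace ℝ (Fin d)) r with hB
  set I := ∫⁻ x in B, ENNReal.ofReal |f x| with hI
  set T := ENNReal.ofReal (t ^ ((d : ℝ) + α)) with hT
  have key : ∀ x ∈ B, volume (Metric.closedBall (0 : EuclideanSpace ℝ (Fin d)) (t / 2)) *
      ENNReal.ofReal (f x ^ 2) ≤ 2 * ENNReal.ofReal |f x| * I + T * ∫⁻ y, eK d α f x y := by
    intro x hx
    have hx' : ‖x‖ ≤ r := by simpa [hB] using hx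
    set c : EuclideanSpace ℝ (Fin d) := (1 - t / (2 * r)) • x with hc
    set Q := Metric.closedBall c (t / 2) with hQ
    have h1 : ‖x - c‖ ≤ t / 2 := by
      have : x - c = (t / (2 * r)) • x := by rw [hc]; module
      rw [this, norm_smul, Real.norm_of_nonneg (by positivity)]
      calc t / (2 * r) * ‖x‖ ≤ t / (2 * r) * r := by gcongr
        _ = t / 2 := by field_simp
    have h2 : ‖c‖ ≤ r - t / 2 := by
      have h3 : t / (2 * r) ≤ 1 := by rw [div_le_one (by positivity)]; linarith
      rw [hc, norm_smul, Real.norm_of_nonneg (by linarith)]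
      calc (1 - t / (2 * r)) * ‖x‖ ≤ (1 - t / (2 * r)) * r :=
            mul_le_mul_of_nonneg_left hx' (by linarith)
        _ = r - t / 2 := by field_simp
    have hQB : Q ⊆ B := by
      intro y hy
      rw [hQ, mem_closedBall_iff_norm] at hy
      rw [hB, mem_closedBall_zero_iff]
      calc ‖y‖ = ‖(y - c) + c‖ := by simp
        _ ≤ ‖y - c‖ + ‖c‖ := norm_add_le _ _
        _ ≤ r := by linarith
    have hQt : ∀ y ∈ Q, ‖x - y‖ ≤ t := by
      intro y hy
      rw [hQ, mem_closedBall_iff_norm, norm_sub_rev] at hy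
      calc ‖x - y‖ = ‖(x - c) + (c - y)‖ := by simp
        _ ≤ ‖x - c‖ + ‖c - y‖ := norm_add_le _ _
        _ ≤ t := by linarith
    have hvol : volume (Metric.closedBall (0 : EuclideanSpace ℝ (Fin d)) (t / 2)) = volume Q := by
      exact (Measure.addHaar_closedBall_center volume c (t / 2)).symm
    calc _ = ∫⁻ y in Q, ENNReal.ofReal (f x ^ 2) := by
          rw [hvol, setLIntegral_const, mul_comm]
      _ ≤ ∫⁻ y in Q, (2 * ENNReal.ofReal |f x| * ENNReal.ofReal |f y| + T * eK d α f x y) := by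
          apply setLIntegral_mono' Metric.isClosed_closedBall.measurableSet
          intro y hy
          refine le_trans ?_ (add_le_add le_rfl (sq_le_eK d α hp f x y t (hQt y hy)))
          have : (2 : ℝ≥0∞) = ENNReal.ofReal 2 := by simp
          rw [this, ← ENNReal.ofReal_mul (by positivity), ← ENNReal.ofReal_mul (by positivity),
            ← ENNReal.ofReal_add (by positivity) (by positivity)]
          apply ENNReal.ofReal_le_ofReal
          have h4 : f x * f y ≤ |f x| * |f y| := by rw [← abs_mul]; exact le_abs_self _
          nlinarith [sq_nonneg (f y)]
      _ = 2 * ENNReal.ofReal |f x| * (∫⁻ y in Q, ENNReal.ofReal |f y|) +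
            T * ∫⁻ y in Q, eK d α f x y := by
          rw [lintegral_add_left (by fun_prop), lintegral_const_mul _ (by fun_prop),
            lintegral_const_mul _ (by exact hK.comp measurable_prodMk_left)]
      _ ≤ _ := by
          gcongr
          · exact lintegral_mono_set hQB
          · exact Measure.restrict_le_self
  calc _ = ∫⁻ x in B, volume (Metric.closedBall (0 : EuclideanSpace ℝ (Fin d)) (t / 2)) *
        ENNReal.ofReal (f x ^ 2) := by rw [lintegral_const_mul _ (by fun_prop)]
    _ ≤ ∫⁻ x in B, (2 * ENNReal.ofReal |f x| * I + T * ∫⁻ y, eK d α f x y) :=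
        setLIntegral_mono' Metric.isClosed_closedBall.measurableSet key
    _ = 2 * I * I + T * ∫⁻ x in B, ∫⁻ y, eK d α f x y := by
        rw [lintegral_add_left (by fun_prop), lintegral_mul_const _ (by fun_prop),
          lintegral_const_mul _ (by fun_prop),
            lintegral_const_mul _ (by exact hK.lintegral_prod_right')]
    _ ≤ _ := by
        rw [pow_two, mul_assoc]
        gcongr
        exact setLIntegral_le_lintegral _ _

lemma eD_lt_top (d : ℕ) (α : ℝ) (hα : α ∈ Set.Ioo (0 : ℝ) 2) (hd : α < d)
    (f : EuclideanSpace ℝ (Fin d) → ℝ) (hf : ContDiff ℝ (⊤ : ℕ∞) f) (hs : HasCompactSupport f) :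
    eD d α f < ∞ := by
  obtain ⟨hα0, hα2⟩ := hα
  have hd1 : 1 ≤ d := by
    rcases Nat.eq_zero_or_pos d with h | h
    · subst h; simp at hd; linarith
    · exact h
  obtain ⟨L, hL⟩ := hf.lipschitzWith_of_hasCompactSupport hs (by simp)
  obtain ⟨M, hM⟩ := hs.exists_bound_of_continuous hf.continuous
  obtain ⟨R, hR0, hR⟩ := hs.isCompact.isBounded.exists_pos_norm_lt
  set B := Metric.closedBall (0 : EuclideanSpace ℝ (Fin d)) R with hB
  have hfB : ∀ x, x ∉ B → f x = 0 := by
    intro x hx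
    by_contra h
    exact hx (by simpa [hB] using (hR x (subset_tsupport f h)).le)
  set p : ℝ := (d : ℝ) + α with hp
  set G : EuclideanSpace ℝ (Fin d) → ℝ≥0∞ := fun h =>
    (Metric.ball 0 1).indicator (fun h => ENNReal.ofReal ((L : ℝ) ^ 2 * ‖h‖ ^ (-(p - 2)))) h +
      ENNReal.ofReal (4 * M ^ 2 * 2 ^ p) * ENNReal.ofReal ((1 + ‖h‖) ^ (-p)) with hG
  have hGm : Measurable G := by
    apply Measurable.add
    · apply Measurable.indicator (by fun_prop) measurableSet_ball
    · fun_prop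
  have hGfin : ∫⁻ h, G h < ∞ := by
    rw [hG, lintegral_add_right _ (by fun_prop), lintegral_indicator measurableSet_ball,
      lintegral_const_mul _ (by fun_prop)]
    apply ENNReal.add_lt_top.2 ⟨?_, ?_⟩
    · have : IntegrableOn (fun h : EuclideanSpace ℝ (Fin d) => (L : ℝ) ^ 2 * ‖h‖ ^ (-(p - 2)))
          (Metric.ball 0 1) := by
        apply integrableOn_ball_of_norm_le_rpow (C := (L : ℝ) ^ 2) (α := p - 2) (by simpa using hd1)
        · simp; linarith
        · refine Filter.Eventually.of_forall fun x => ?_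
          rw [Real.norm_of_nonneg (by positivity)]
        · exact Measurable.aestronglyMeasurable (by fun_prop)
      exact this.setLIntegral_lt_top
    · apply ENNReal.mul_lt_top ENNReal.ofReal_lt_top
      exact finite_integral_one_add_norm (by simp; linarith)
  have hbound : ∀ x y, eK d α f x y ≤ G (x - y) := by
    intro x y
    simp only [hG, eK]
    rw [← hp]
    by_cases h : ‖x - y‖ < 1
    · rw [Set.indicator_of_mem (by simpa using h)]
      refine le_trans (ENNReal.ofReal_le_ofReal ?_) le_self_add
      by_cases hxy : x = y
      · subst hxy; simp; positivity
      have h0 : 0 < ‖x - y‖ := norm_pos_iff.2 (sub_ne_zero.2 hxy)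
      have h1 : |f x - f y| ≤ L * ‖x - y‖ := by
        have := hL.dist_le_mul x y
        rwa [Real.dist_eq, dist_eq_norm] at this
      have h2 : (f x - f y) ^ 2 ≤ (L * ‖x - y‖) ^ 2 := by
        rw [← sq_abs]; gcongr
      rw [div_le_iff₀ (by positivity), mul_assoc, ← Real.rpow_add h0]
      have : -(p - 2) + p = (2 : ℕ) := by push_cast; ring
      rw [this, Real.rpow_natCast, ← mul_pow]
      exact h2
    · push Not at h
      refine le_trans ?_ le_add_self
      rw [← ENNReal.ofReal_mul (by positivity)]
      apply ENNReal.ofReal_le_ofReal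
      have hfx := abs_le.1 (hM x)
      have hfy := abs_le.1 (hM y)
      have h2 : (f x - f y) ^ 2 ≤ 4 * M ^ 2 := by
        have : (f x - f y) ^ 2 ≤ (2 * M) ^ 2 := sq_le_sq' (by linarith) (by linarith)
        linarith
      have h3 : (1 + ‖x - y‖) ^ p ≤ 2 ^ p * ‖x - y‖ ^ p := by
        rw [← Real.mul_rpow (by norm_num) (by positivity)]
        exact Real.rpow_le_rpow (by positivity) (by linarith) (by positivity)
      have h4 : 0 < ‖x - y‖ ^ p := Real.rpow_pos_of_pos (by linarith) _
      have h5 : 0 < (1 + ‖x - y‖) ^ p := by positivity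
      rw [Real.rpow_neg (by positivity), div_le_iff₀ h4, mul_right_comm, ← div_eq_mul_inv,
        le_div_iff₀ h5, mul_assoc]
      gcongr
  have hbound2 : ∀ x y, eK d α f x y ≤ B.indicator (fun _ => 1) x * G (x - y) +
      B.indicator (fun _ => 1) y * G (x - y) := by
    intro x y
    by_cases hx : x ∈ B
    · rw [Set.indicator_of_mem hx, one_mul]
      exact (hbound x y).trans le_self_add
    by_cases hy : y ∈ B
    · rw [Set.indicator_of_mem hy, one_mul]
      exact (hbound x y).trans le_add_self
    · simp [eK, hfB x hx, hfB y hy]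
  have hBm : MeasurableSet B := Metric.isClosed_closedBall.measurableSet
  have hind : Measurable (B.indicator (fun _ => (1 : ℝ≥0∞))) := measurable_const.indicator hBm
  have hBfin : volume B < ∞ := measure_closedBall_lt_top
  have hm1 : Measurable fun z : EuclideanSpace ℝ (Fin d) × EuclideanSpace ℝ (Fin d) =>
      B.indicator (fun _ => (1 : ℝ≥0∞)) z.1 * G (z.1 - z.2) :=
    (hind.comp measurable_fst).mul (hGm.comp (by fun_prop))
  have hm2 : Measurable fun z : EuclideanSpace ℝ (Fin d) × EuclideanSpace ℝ (Fin d) =>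
      B.indicator (fun _ => (1 : ℝ≥0∞)) z.2 * G (z.1 - z.2) :=
    (hind.comp measurable_snd).mul (hGm.comp (by fun_prop))
  clear_value G B
  calc eD d α f ≤ ∫⁻ x, ∫⁻ y, (B.indicator (fun _ => 1) x * G (x - y) +
      B.indicator (fun _ => 1) y * G (x - y)) := by
        unfold eD
        gcongr with x y
        exact hbound2 x y
    _ = (∫⁻ x, ∫⁻ y, B.indicator (fun _ => 1) x * G (x - y)) +
        ∫⁻ x, ∫⁻ y, B.indicator (fun _ => 1) y * G (x - y) := by
        have h1 : ∀ x, ∫⁻ y, (B.indicator (fun _ => 1) x * G (x - y) +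
            B.indicator (fun _ => 1) y * G (x - y)) =
            (∫⁻ y, B.indicator (fun _ => 1) x * G (x - y)) +
              ∫⁻ y, B.indicator (fun _ => 1) y * G (x - y) := fun x =>
          lintegral_add_left (hm1.comp measurable_prodMk_left) _
        simp_rw [h1]
        exact lintegral_add_left hm1.lintegral_prod_right' _
    _ = volume B * (∫⁻ h, G h) + volume B * ∫⁻ h, G h := by
        congr 1
        · have : ∀ x, ∫⁻ y, B.indicator (fun _ => 1) x * G (x - y) =
              B.indicator (fun _ => 1) x * ∫⁻ h, G h := by
            intro x
            rw [lintegral_const_mul _ (by fun_prop), lintegral_sub_left_eq_self G x]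
          simp_rw [this]
          rw [lintegral_mul_const _ hind, lintegral_indicator hBm]
          simp
        · rw [lintegral_lintegral_swap (by exact hm2.aemeasurable)]
          have : ∀ y, ∫⁻ x, B.indicator (fun _ => 1) y * G (x - y) =
              B.indicator (fun _ => 1) y * ∫⁻ h, G h := by
            intro x
            rw [lintegral_const_mul _ (by fun_prop), lintegral_sub_right_eq_self G x]
          simp_rw [this]
          rw [lintegral_mul_const _ hind, lintegral_indicator hBm]
          simp
    _ < ∞ := by
        have := ENNReal.mul_lt_top hBfin hGfin
        exact ENNReal.add_lt_top.2 ⟨this, this⟩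

lemma ofReal_fracD (d : ℕ) (α : ℝ) (hα : α ∈ Set.Ioo (0 : ℝ) 2) (hd : α < d)
    (f : EuclideanSpace ℝ (Fin d) → ℝ) (hf : ContDiff ℝ (⊤ : ℕ∞) f) (hs : HasCompactSupport f) :
    ENNReal.ofReal (fracD d α f) = eD d α f := by
  have hfin := eD_lt_top d α hα hd f hf hs
  have hK := measurable_eK d α f hf.continuous
  have hfm := hf.continuous.measurable
  have h1 : ∀ x, ∫ y, (f x - f y) ^ 2 / ‖x - y‖ ^ ((d : ℝ) + α) =
      (∫⁻ y, eK d α f x y).toReal := by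
    intro x
    rw [integral_eq_lintegral_of_nonneg_ae]
    · rfl
    · exact Filter.Eventually.of_forall fun y => by simp only [Pi.zero_apply]; positivity
    · exact Measurable.aestronglyMeasurable (by fun_prop)
  have hm : Measurable fun x => ∫⁻ y, eK d α f x y := hK.lintegral_prod_right'
  have : fracD d α f = (eD d α f).toReal := by
    unfold fracD
    simp_rw [h1]
    rw [integral_toReal hm.aemeasurable (ae_lt_top hm hfin.ne)]
    rfl
  rw [this, ENNReal.ofReal_toReal hfin.ne]

lemma vol_cb (d : ℕ) : ∃ v : ℝ, 0 < v ∧ ∀ a : ℝ, 0 ≤ a →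
    volume (Metric.closedBall (0 : EuclideanSpace ℝ (Fin d)) a) = ENNReal.ofReal (a ^ d * v) := by
  refine ⟨(volume (Metric.closedBall (0 : EuclideanSpace ℝ (Fin d)) 1)).toReal, ?_, ?_⟩
  · exact ENNReal.toReal_pos (Metric.measure_closedBall_pos volume _ one_pos).ne'
      measure_closedBall_lt_top.ne
  · intro a ha
    rw [Measure.addHaar_closedBall' _ _ ha, ENNReal.ofReal_mul (by positivity),
      ENNReal.ofReal_toReal measure_closedBall_lt_top.ne]
    simp

lemma hardy_fin (d : ℕ) (α : ℝ) (hd1 : 1 ≤ d) (hd : α < d)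
    (f : EuclideanSpace ℝ (Fin d) → ℝ) (hf : Continuous f) (hs : HasCompactSupport f) :
    ∫⁻ x, ENNReal.ofReal (f x ^ 2 * ‖x‖ ^ (-α)) < ∞ := by
  have hfm := hf.measurable
  obtain ⟨M, hM⟩ := hs.exists_bound_of_continuous hf
  obtain ⟨R, hR0, hR⟩ := hs.isCompact.isBounded.exists_pos_norm_lt
  have h1 : IntegrableOn (fun x => f x ^ 2 * ‖x‖ ^ (-α)) (Metric.ball 0 R) := by
    apply integrableOn_ball_of_norm_le_rpow (C := M ^ 2) (α := α) (by simpa using hd1)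
    · simpa using hd
    · refine Filter.Eventually.of_forall fun x => ?_
      rw [Real.norm_of_nonneg (by positivity)]
      have := hM x
      rw [Real.norm_eq_abs] at this
      rw [← sq_abs]
      gcongr
    · exact Measurable.aestronglyMeasurable (by fun_prop)
  rw [integrableOn_iff_integrable_of_support_subset] at h1
  · exact h1.lintegral_lt_top
  · intro x hx
    have : f x ≠ 0 := by
      intro h
      simp [h] at hx
    simpa using hR x (subset_tsupport f this)

lemma hardy (d : ℕ) (α : ℝ) (hα : 0 < α) (hd : α < d) : ∃ C : ℝ, 0 < C ∧
    ∀ f : EuclideanSpace ℝ (Fin d) → ℝ, Continuous f → HasCompactSupport f → eD d α f < ∞ →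
      ∫⁻ x, ENNReal.ofReal (f x ^ 2 * ‖x‖ ^ (-α)) ≤ ENNReal.ofReal C * eD d α f := by
  have hd1 : 1 ≤ d := by
    rcases Nat.eq_zero_or_pos d with h | h
    · subst h; simp at hd; linarith
    · exact h
  obtain ⟨v, hv, hvol⟩ := vol_cb d
  set p : ℝ := (d : ℝ) + α with hp
  have hp0 : 0 < p := by positivity
  obtain ⟨l, hl0, hl⟩ : ∃ l : ℝ, 0 < l ∧ 2 * (2 * 2 ^ p * l ^ α) = l ^ d := by
    refine ⟨(4 * 2 ^ p) ^ (1 / ((d : ℝ) - α)), by positivity, ?_⟩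
    have h0 : (0 : ℝ) < 4 * 2 ^ p := by positivity
    have h1 : (d : ℝ) - α ≠ 0 := by linarith
    rw [← Real.rpow_natCast, ← Real.rpow_mul h0.le, ← Real.rpow_mul h0.le, ← mul_assoc, ← mul_assoc]
    norm_num
    nth_rw 1 [← Real.rpow_one (4 * 2 ^ p)]
    rw [← Real.rpow_add h0]
    congr 1
    field_simp
    ring
  set K : ℝ := 2 * (2 * l + 1) ^ p with hK
  have hK0 : 0 < K := by positivity
  refine ⟨2 * K / (l ^ d * v), by positivity, ?_⟩
  intro f hf hs hD
  have hfm := hf.measurable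
  have hH := hardy_fin d α hd1 hd f hf hs
  have hKm := measurable_eK d α f hf
  set H := ∫⁻ x, ENNReal.ofReal (f x ^ 2 * ‖x‖ ^ (-α)) with hHdef
  set S : Set (EuclideanSpace ℝ (Fin d) × EuclideanSpace ℝ (Fin d)) :=
    {z | l * ‖z.1‖ < ‖z.2‖ ∧ ‖z.2‖ ≤ 2 * l * ‖z.1‖} with hS
  have hSm : MeasurableSet S := by
    rw [hS, Set.ofPred_and]
    exact (measurableSet_lt (by fun_prop) (by fun_prop)).inter
      (measurableSet_le (by fun_prop) (by fun_prop))
  set F : EuclideanSpace ℝ (Fin d) × EuclideanSpace ℝ (Fin d) → ℝ≥0∞ :=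
    S.indicator (fun z => ENNReal.ofReal (2 * (f z.2 ^ 2 * ‖z.1‖ ^ (-p)))) with hF
  have hFm : Measurable F := Measurable.indicator (by fun_prop) hSm
  -- lower bound
  have key1 : ∀ x, ENNReal.ofReal (l ^ d * v) * ENNReal.ofReal (f x ^ 2 * ‖x‖ ^ (-α)) ≤
      (∫⁻ y, F (x, y)) + ENNReal.ofReal K * ∫⁻ y, eK d α f x y := by
    intro x
    by_cases hx : x = 0
    · subst hx
      simp [Real.zero_rpow (neg_ne_zero.2 hα.ne')]
    have hx0 : 0 < ‖x‖ := norm_pos_iff.2 hx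
    set A := Metric.closedBall (0 : EuclideanSpace ℝ (Fin d)) (2 * l * ‖x‖) \
      Metric.closedBall 0 (l * ‖x‖) with hA
    have hAm : MeasurableSet A :=
      Metric.isClosed_closedBall.measurableSet.diff Metric.isClosed_closedBall.measurableSet
    have hAS : ∀ y, y ∈ A → (x, y) ∈ S := by
      intro y hy
      simp [hA] at hy
      exact ⟨hy.2, hy.1⟩
    have hAvol : ENNReal.ofReal ((l * ‖x‖) ^ d * v) ≤ volume A := by
      refine le_trans ?_ le_measure_sdiff
      rw [hvol _ (by positivity), hvol _ (by positivity), ← ENNReal.ofReal_sub _ (by positivity)]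
      apply ENNReal.ofReal_le_ofReal
      have : (2 : ℝ) ≤ 2 ^ d := by
        calc (2 : ℝ) = 2 ^ 1 := by norm_num
          _ ≤ 2 ^ d := pow_le_pow_right₀ (by norm_num) hd1
      have h3 : (2 * l * ‖x‖) ^ d = 2 ^ d * (l * ‖x‖) ^ d := by rw [mul_assoc, mul_pow]
      have h4 : 0 ≤ (l * ‖x‖) ^ d * v := by positivity
      rw [h3]
      nlinarith
    calc _ = ENNReal.ofReal ((l * ‖x‖) ^ d * v) * ENNReal.ofReal (f x ^ 2 * ‖x‖ ^ (-p)) := by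
          rw [← ENNReal.ofReal_mul (by positivity), ← ENNReal.ofReal_mul (by positivity)]
          congr 1
          have : ‖x‖ ^ (-α) = ‖x‖ ^ d * ‖x‖ ^ (-p) := by
            rw [← Real.rpow_natCast, ← Real.rpow_add hx0]
            congr 1
            rw [hp]; ring
          rw [this, mul_pow]; ring
      _ ≤ volume A * ENNReal.ofReal (f x ^ 2 * ‖x‖ ^ (-p)) := by gcongr
      _ = ∫⁻ y in A, ENNReal.ofReal (f x ^ 2 * ‖x‖ ^ (-p)) := by
          rw [setLIntegral_const, mul_comm]
      _ ≤ ∫⁻ y in A, (F (x, y) + ENNReal.ofReal K * eK d α f x y) := by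
          apply setLIntegral_mono' hAm
          intro y hy
          have hyS := hAS y hy
          have hxy : ‖x - y‖ ≤ (2 * l + 1) * ‖x‖ := by
            have := norm_sub_le x y
            have := hyS.2
            simp only at this
            linarith
          have h5 := sq_le_eK d α hp0 f x y _ hxy
          have h6 : ENNReal.ofReal (2 * ((f x - f y) ^ 2 * ‖x‖ ^ (-p))) ≤
              ENNReal.ofReal K * eK d α f x y := by
            calc _ = ENNReal.ofReal (2 * ‖x‖ ^ (-p)) * ENNReal.ofReal ((f x - f y) ^ 2) := by
                  rw [← ENNReal.ofReal_mul (by positivity)]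
                  congr 1; ring
              _ ≤ ENNReal.ofReal (2 * ‖x‖ ^ (-p)) *
                  (ENNReal.ofReal (((2 * l + 1) * ‖x‖) ^ p) * eK d α f x y) := by gcongr
              _ = _ := by
                  rw [← mul_assoc, ← ENNReal.ofReal_mul (by positivity)]
                  congr 2
                  rw [hK, Real.mul_rpow (by positivity) (by positivity), Real.rpow_neg hx0.le]
                  have : ‖x‖ ^ p ≠ 0 := by positivity
                  field_simp
          refine le_trans ?_ (add_le_add le_rfl h6)
          rw [hF, Set.indicator_of_mem hyS, ← ENNReal.ofReal_add (by positivity) (by positivity)]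
          apply ENNReal.ofReal_le_ofReal
          have h7 : f x ^ 2 ≤ 2 * f y ^ 2 + 2 * (f x - f y) ^ 2 := by
            nlinarith [sq_nonneg (f x - 2 * f y)]
          have h8 : 0 ≤ ‖x‖ ^ (-p) := by positivity
          have := mul_le_mul_of_nonneg_right h7 h8
          simp only
          linarith
      _ ≤ ∫⁻ y, (F (x, y) + ENNReal.ofReal K * eK d α f x y) := setLIntegral_le_lintegral _ _
      _ = _ := by
          rw [lintegral_add_left (by exact hFm.comp measurable_prodMk_left),
            lintegral_const_mul _ (by exact hKm.comp measurable_prodMk_left)]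
  have key2 : ∀ y, ∫⁻ x, F (x, y) ≤
      ENNReal.ofReal (2 * 2 ^ p * l ^ α * v) * ENNReal.ofReal (f y ^ 2 * ‖y‖ ^ (-α)) := by
    intro y
    by_cases hy : y = 0
    · have : ∀ x, F (x, y) = 0 := by
        intro x
        rw [hF]
        apply Set.indicator_of_notMem
        rintro ⟨h, -⟩
        simp only [hy, norm_zero] at h
        have : 0 ≤ l * ‖x‖ := by positivity
        linarith
      simp [this]
    have hy0 : 0 < ‖y‖ := norm_pos_iff.2 hy
    have hpt : ∀ x, F (x, y) ≤ (Metric.closedBall 0 (‖y‖ / l)).indicator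
        (fun _ => ENNReal.ofReal (2 * (f y ^ 2 * (‖y‖ / (2 * l)) ^ (-p)))) x := by
      intro x
      by_cases hxS : (x, y) ∈ S
      · have h1 := hxS.1
        have h2 := hxS.2
        simp only at h1 h2
        have hxm : x ∈ Metric.closedBall (0 : EuclideanSpace ℝ (Fin d)) (‖y‖ / l) := by
          rw [mem_closedBall_zero_iff, le_div_iff₀ hl0]; linarith
        rw [hF, Set.indicator_of_mem hxS, Set.indicator_of_mem hxm]
        apply ENNReal.ofReal_le_ofReal
        have : ‖x‖ ^ (-p) ≤ (‖y‖ / (2 * l)) ^ (-p) := by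
          apply Real.rpow_le_rpow_of_nonpos (by positivity) _ (by linarith)
          rw [div_le_iff₀ (by positivity)]; linarith
        simp only
        gcongr
      · rw [hF, Set.indicator_of_notMem hxS]; exact zero_le
    calc _ ≤ ∫⁻ x, (Metric.closedBall 0 (‖y‖ / l)).indicator
          (fun _ => ENNReal.ofReal (2 * (f y ^ 2 * (‖y‖ / (2 * l)) ^ (-p)))) x := lintegral_mono hpt
      _ = _ := by
        rw [lintegral_indicator Metric.isClosed_closedBall.measurableSet, setLIntegral_const,
          hvol _ (by positivity), ← ENNReal.ofReal_mul (by positivity),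
          ← ENNReal.ofReal_mul (by positivity)]
        congr 1
        rw [Real.div_rpow hy0.le (by positivity), Real.mul_rpow (by norm_num) hl0.le, div_pow,
          Real.rpow_neg (x := 2) (by norm_num), Real.rpow_neg (x := l) hl0.le,
          Real.rpow_neg hy0.le, Real.rpow_neg hy0.le, hp, Real.rpow_add hy0, Real.rpow_add hl0,
          Real.rpow_natCast, Real.rpow_natCast]
        have e1 : ‖y‖ ^ α ≠ 0 := by positivity
        have e2 : l ^ α ≠ 0 := by positivity
        field_simp
  have main : ENNReal.ofReal (l ^ d * v) * H ≤
      ENNReal.ofReal (2 * 2 ^ p * l ^ α * v) * H + ENNReal.ofReal K * eD d α f := by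
    calc _ = ∫⁻ x, ENNReal.ofReal (l ^ d * v) * ENNReal.ofReal (f x ^ 2 * ‖x‖ ^ (-α)) := by
          rw [lintegral_const_mul _ (by fun_prop)]
      _ ≤ ∫⁻ x, ((∫⁻ y, F (x, y)) + ENNReal.ofReal K * ∫⁻ y, eK d α f x y) := lintegral_mono key1
      _ = (∫⁻ x, ∫⁻ y, F (x, y)) + ENNReal.ofReal K * eD d α f := by
          rw [lintegral_add_left hFm.lintegral_prod_right',
            lintegral_const_mul _ (by exact hKm.lintegral_prod_right')]
          rfl
      _ = (∫⁻ y, ∫⁻ x, F (x, y)) + ENNReal.ofReal K * eD d α f := by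
          rw [lintegral_lintegral_swap (f := fun x y => F (x, y)) (by exact hFm.aemeasurable)]
      _ ≤ _ := by
          gcongr
          rw [← lintegral_const_mul _ (by fun_prop)]
          exact lintegral_mono key2
  clear_value H
  clear key1 key2
  generalize eD d α f = D at *
  have hHn : 0 ≤ H.toReal := ENNReal.toReal_nonneg
  have hDn : 0 ≤ D.toReal := ENNReal.toReal_nonneg
  rw [← ENNReal.ofReal_toReal hH.ne, ← ENNReal.ofReal_toReal hD.ne] at main ⊢
  rw [← ENNReal.ofReal_mul (by positivity), ← ENNReal.ofReal_mul (by positivity),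
    ← ENNReal.ofReal_mul (by positivity), ← ENNReal.ofReal_add (by positivity) (by positivity),
    ENNReal.ofReal_le_ofReal_iff (by positivity)] at main
  rw [← ENNReal.ofReal_mul (by positivity)]
  apply ENNReal.ofReal_le_ofReal
  rw [div_mul_eq_mul_div, le_div_iff₀ (by positivity)]
  rw [← hl] at main ⊢
  linarith

theorem super_poincare_with_hardy
    (d : ℕ) (α : ℝ) (hα : α ∈ Set.Ioo (0 : ℝ) 2) (hd : α < d)
    (W : EuclideanSpace ℝ (Fin d) → ℝ) (hWmeas : Measurable W)
    (hW1 : ∀ x, 1 ≤ W x)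
    (hWbdd : ∃ M : ℝ, ∀ x : EuclideanSpace ℝ (Fin d), 1 ≤ ‖x‖ → ‖x‖ ^ α / W x ≤ M) :
    ∃ c₀ > (0 : ℝ), ∃ c₁ > (0 : ℝ), ∀ s r : ℝ, 0 < s → 0 < r →
      ∀ f : EuclideanSpace ℝ (Fin d) → ℝ, ContDiff ℝ (⊤ : ℕ∞) f → HasCompactSupport f →
        ∫ x, (f x) ^ 2 * (W x)⁻¹ ≤
          (s + c₁ * sSup ((fun x => ‖x‖ ^ α / W x) ''
              {x : EuclideanSpace ℝ (Fin d) | r ≤ ‖x‖})) * fracD d α f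
            + c₀ * (1 + s ^ (-(d : ℝ) / α)) *
                (∫ x in {x : EuclideanSpace ℝ (Fin d) | ‖x‖ ≤ r}, |f x|) ^ 2 := by
  obtain ⟨hα0, hα2⟩ := id hα
  obtain ⟨C, hC, hardyC⟩ := hardy d α hα0 hd
  obtain ⟨v, hv, hvol⟩ := vol_cb d
  obtain ⟨M, hM⟩ := hWbdd
  set A : ℝ := max (2 ^ d / v) C with hA
  have hA0 : 0 < A := lt_max_of_lt_right hC
  refine ⟨2 * A * A ^ ((d : ℝ) / α), by positivity, C, hC, ?_⟩
  intro s r hs hr f hf hfs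
  have hfm := hf.continuous.measurable
  have hDfin := eD_lt_top d α hα hd f hf hfs
  have hDeq := ofReal_fracD d α hα hd f hf hfs
  have hH := hardyC f hf.continuous hfs hDfin
  have hD0 : 0 ≤ fracD d α f :=
    integral_nonneg fun x => integral_nonneg fun y => by positivity
  rw [← hDeq, ← ENNReal.ofReal_mul hC.le] at hH
  set D := fracD d α f with hDdef
  have hset : {x : EuclideanSpace ℝ (Fin d) | ‖x‖ ≤ r} = Metric.closedBall 0 r := by
    ext x; simp
  rw [hset]
  set B := Metric.closedBall (0 : EuclideanSpace ℝ (Fin d)) r with hB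
  have hBm : MeasurableSet B := Metric.isClosed_closedBall.measurableSet
  set I := ∫ x in B, |f x| with hI
  have hI0 : 0 ≤ I := integral_nonneg fun x => abs_nonneg _
  have hIeq : ∫⁻ x in B, ENNReal.ofReal |f x| = ENNReal.ofReal I := by
    rw [hI, ofReal_integral_eq_lintegral_ofReal]
    · exact ((hf.continuous.integrable_of_hasCompactSupport hfs).abs).integrableOn
    · exact Filter.Eventually.of_forall fun x => abs_nonneg _
  set P := sSup ((fun x => ‖x‖ ^ α / W x) '' {x : EuclideanSpace ℝ (Fin d) | r ≤ ‖x‖}) with hP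
  have hW0 : ∀ x, 0 < W x := fun x => one_pos.trans_le (hW1 x)
  have hPbdd : BddAbove ((fun x => ‖x‖ ^ α / W x) '' {x : EuclideanSpace ℝ (Fin d) | r ≤ ‖x‖}) := by
    refine ⟨max M 1, ?_⟩
    rintro _ ⟨x, -, rfl⟩
    by_cases hx : 1 ≤ ‖x‖
    · exact le_max_of_le_left (hM x hx)
    · apply le_max_of_le_right
      simp only
      rw [div_le_one (hW0 x)]
      exact (Real.rpow_le_one (norm_nonneg _) (by linarith) hα0.le).trans (hW1 x)
  have hPle : ∀ x : EuclideanSpace ℝ (Fin d), r ≤ ‖x‖ → ‖x‖ ^ α / W x ≤ P := fun x hx =>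
    le_csSup hPbdd ⟨x, hx, rfl⟩
  have hP0 : 0 ≤ P := by
    apply Real.sSup_nonneg
    rintro _ ⟨x, -, rfl⟩
    have := hW0 x
    simp only
    positivity
  -- the outer part
  have hout : ∫⁻ x in Bᶜ, ENNReal.ofReal (f x ^ 2 * (W x)⁻¹) ≤ ENNReal.ofReal (C * P * D) := by
    calc _ ≤ ∫⁻ x in Bᶜ, ENNReal.ofReal P * ENNReal.ofReal (f x ^ 2 * ‖x‖ ^ (-α)) := by
          apply setLIntegral_mono' hBm.compl
          intro x hx
          have hx' : r < ‖x‖ := by simpa [hB] using hx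
          have hx0 : 0 < ‖x‖ := hr.trans hx'
          rw [← ENNReal.ofReal_mul hP0]
          apply ENNReal.ofReal_le_ofReal
          have h1 := hPle x hx'.le
          have h2 : (W x)⁻¹ = ‖x‖ ^ α / W x * ‖x‖ ^ (-α) := by
            rw [Real.rpow_neg hx0.le]
            have : ‖x‖ ^ α ≠ 0 := by positivity
            field_simp
          calc f x ^ 2 * (W x)⁻¹ = ‖x‖ ^ α / W x * (f x ^ 2 * ‖x‖ ^ (-α)) := by rw [h2]; ring
            _ ≤ _ := by gcongr
      _ ≤ ∫⁻ x, ENNReal.ofReal P * ENNReal.ofReal (f x ^ 2 * ‖x‖ ^ (-α)) :=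
          setLIntegral_le_lintegral _ _
      _ = ENNReal.ofReal P * ∫⁻ x, ENNReal.ofReal (f x ^ 2 * ‖x‖ ^ (-α)) := by
          rw [lintegral_const_mul _ (by fun_prop)]
      _ ≤ ENNReal.ofReal P * ENNReal.ofReal (C * D) := by gcongr
      _ = _ := by rw [← ENNReal.ofReal_mul hP0]; congr 1; ring
  -- the inner part
  set c := 2 * A * A ^ ((d : ℝ) / α) * (1 + s ^ (-(d : ℝ) / α)) with hc
  have hc0 : 0 ≤ c := by positivity
  have hin : ∫⁻ x in B, ENNReal.ofReal (f x ^ 2) ≤ ENNReal.ofReal (s * D + c * I ^ 2) := by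
    set t : ℝ := (s / A) ^ (1 / α) with ht
    have ht0 : 0 < t := by positivity
    have htα : A * t ^ α = s := by
      rw [ht, ← Real.rpow_mul (by positivity), one_div_mul_cancel hα0.ne', Real.rpow_one]
      field_simp
    rcases le_or_gt t r with htr | htr
    · have h1 := local_sp d α (by positivity) f hf.continuous t r ht0 htr
      rw [hvol _ (by positivity), hIeq, ← hDeq, ← ENNReal.ofReal_pow hI0,
        ← ENNReal.ofReal_mul (by positivity)] at h1
      have h2 : 2 * ENNReal.ofReal (I ^ 2) = ENNReal.ofReal 2 * ENNReal.ofReal (I ^ 2) := by simp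
      rw [h2, ← ENNReal.ofReal_mul (by positivity),
        ← ENNReal.ofReal_add (by positivity) (by positivity)] at h1
      have hw : 0 < (t / 2) ^ d * v := by positivity
      have h3 : ∫⁻ x in B, ENNReal.ofReal (f x ^ 2) ≤
          ENNReal.ofReal ((2 * I ^ 2 + t ^ ((d : ℝ) + α) * D) / ((t / 2) ^ d * v)) := by
        rw [ENNReal.ofReal_div_of_pos hw, ENNReal.le_div_iff_mul_le]
        · rw [mul_comm]; exact h1
        · left; simpa using hw
        · left; exact ENNReal.ofReal_ne_top
      refine h3.trans (ENNReal.ofReal_le_ofReal ?_)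
      have h4 : (2 * I ^ 2 + t ^ ((d : ℝ) + α) * D) / ((t / 2) ^ d * v) =
          (2 ^ d / v) * (2 * (t ^ d)⁻¹ * I ^ 2 + t ^ α * D) := by
        rw [Real.rpow_add ht0, Real.rpow_natCast, div_pow]
        field_simp
      have h5 : (t ^ d)⁻¹ = A ^ ((d : ℝ) / α) * s ^ (-(d : ℝ) / α) := by
        rw [ht, ← Real.rpow_natCast, ← Real.rpow_mul (by positivity), ← Real.rpow_neg (by positivity),
          Real.div_rpow hs.le hA0.le]
        have : -(1 / α * (d : ℝ)) = -(d : ℝ) / α := by ring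
        rw [this, div_eq_mul_inv, ← Real.rpow_neg hA0.le, mul_comm]
        congr 2
        ring
      rw [h4]
      calc _ ≤ A * (2 * (t ^ d)⁻¹ * I ^ 2 + t ^ α * D) := by
            gcongr
            exact le_max_left _ _
        _ = s * D + 2 * A * A ^ ((d : ℝ) / α) * s ^ (-(d : ℝ) / α) * I ^ 2 := by
            rw [h5, ← htα]; ring
        _ ≤ _ := by
            rw [hc]
            gcongr
            linarith
    · calc _ ≤ ∫⁻ x in B, ENNReal.ofReal (r ^ α) * ENNReal.ofReal (f x ^ 2 * ‖x‖ ^ (-α)) := by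
            have hd1 : 1 ≤ d := by
              rcases Nat.eq_zero_or_pos d with h | h
              · subst h; simp at hd; linarith
              · exact h
            have : Nonempty (Fin d) := ⟨⟨0, hd1⟩⟩
            apply lintegral_mono_ae
            have h0 : ∀ᵐ x ∂(volume : Measure (EuclideanSpace ℝ (Fin d))), x ≠ 0 := by
              rw [ae_iff]; simp
            filter_upwards [ae_restrict_mem hBm, ae_restrict_of_ae h0] with x hx hx0
            have hx' : ‖x‖ ≤ r := by simpa [hB] using hx
            have hx1 : 0 < ‖x‖ := norm_pos_iff.2 hx0
            rw [← ENNReal.ofReal_mul (by positivity)]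
            apply ENNReal.ofReal_le_ofReal
            have h1 : ‖x‖ ^ α ≤ r ^ α := Real.rpow_le_rpow hx1.le hx' hα0.le
            calc f x ^ 2 = ‖x‖ ^ α * (f x ^ 2 * ‖x‖ ^ (-α)) := by
                  rw [Real.rpow_neg hx1.le]
                  have : ‖x‖ ^ α ≠ 0 := by positivity
                  field_simp
              _ ≤ _ := by gcongr
        _ ≤ ∫⁻ x, ENNReal.ofReal (r ^ α) * ENNReal.ofReal (f x ^ 2 * ‖x‖ ^ (-α)) :=
            setLIntegral_le_lintegral _ _
        _ = ENNReal.ofReal (r ^ α) * ∫⁻ x, ENNReal.ofReal (f x ^ 2 * ‖x‖ ^ (-α)) := by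
            rw [lintegral_const_mul _ (by fun_prop)]
        _ ≤ ENNReal.ofReal (r ^ α) * ENNReal.ofReal (C * D) := by gcongr
        _ ≤ _ := by
            rw [← ENNReal.ofReal_mul (by positivity)]
            apply ENNReal.ofReal_le_ofReal
            have h1 : r ^ α ≤ t ^ α := Real.rpow_le_rpow hr.le htr.le hα0.le
            have h2 : C ≤ A := le_max_right _ _
            calc r ^ α * (C * D) ≤ t ^ α * (A * D) := by gcongr
              _ = s * D := by rw [← htα]; ring
              _ ≤ _ := le_add_of_nonneg_right (by positivity)
  have htot : ∫⁻ x, ENNReal.ofReal (f x ^ 2 * (W x)⁻¹) ≤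
      ENNReal.ofReal ((s + C * P) * D + c * I ^ 2) := by
    rw [← lintegral_add_compl _ hBm]
    calc _ ≤ ENNReal.ofReal (s * D + c * I ^ 2) + ENNReal.ofReal (C * P * D) := by
          refine add_le_add (le_trans ?_ hin) hout
          apply lintegral_mono
          intro x
          apply ENNReal.ofReal_le_ofReal
          exact mul_le_of_le_one_right (sq_nonneg _) (inv_le_one_of_one_le₀ (hW1 x))
      _ = _ := by
          rw [← ENNReal.ofReal_add (by positivity) (by positivity)]
          congr 1; ring
  rw [integral_eq_lintegral_of_nonneg_ae]
  · exact ENNReal.toReal_le_of_le_ofReal (by positivity) htot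
  · refine Filter.Eventually.of_forall fun x => ?_
    have := hW0 x
    simp only [Pi.zero_apply]
    positivity
  · exact Measurable.aestronglyMeasurable (by fun_prop)
end

section
/- Suppose sup_{x ∈ ℝ^d} W(x)/(1 + |x|)^α < ∞. Then there is no function β : (0,∞) → (0,∞) such that for all r > 0 and all f ∈ C_c^∞(ℝ^d): ∫_{ℝ^d} f² dμ ≤ r·D(f,f) + β(r)·( ∫_{ℝ^d} |f(x)|·e^{-|x|} μ(dx) )². Equivalently, for every function β : (0,∞) → (0,∞) there exist r > 0 and f ∈ C_c^∞(ℝ^d) for which this inequality fails. -/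
open MeasureTheory

lemma fracD_scale (d : ℕ) (α : ℝ) (φ : EuclideanSpace ℝ (Fin d) → ℝ) (t : ℝ) (ht : 0 < t) :
    fracD d α (fun x => φ (t⁻¹ • x)) = t ^ d * (t ^ α)⁻¹ * fracD d α φ := by
  unfold fracD
  have key : ∀ x y : EuclideanSpace ℝ (Fin d),
      (φ (t⁻¹ • x) - φ (t⁻¹ • y)) ^ 2 / ‖x - y‖ ^ ((d : ℝ) + α)
        = (t ^ ((d : ℝ) + α))⁻¹ * ((φ (t⁻¹ • x) - φ (t⁻¹ • y)) ^ 2 /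
          ‖t⁻¹ • x - t⁻¹ • y‖ ^ ((d : ℝ) + α)) := by
    intro x y
    rw [← smul_sub, norm_smul, Real.norm_of_nonneg (by positivity),
      Real.mul_rpow (by positivity) (by positivity), Real.inv_rpow ht.le]
    have : t ^ ((d : ℝ) + α) ≠ 0 := (Real.rpow_pos_of_pos ht _).ne'
    rw [mul_comm (t ^ ((d : ℝ) + α))⁻¹ (‖x - y‖ ^ ((d : ℝ) + α)), ← div_div, div_inv_eq_mul]
    field_simp
  have hin : ∀ x : EuclideanSpace ℝ (Fin d),
      ∫ y, (φ (t⁻¹ • x) - φ (t⁻¹ • y)) ^ 2 / ‖x - y‖ ^ ((d : ℝ) + α)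
      = (t ^ ((d : ℝ) + α))⁻¹ * (t ^ d * ∫ y, (φ (t⁻¹ • x) - φ y) ^ 2 /
          ‖t⁻¹ • x - y‖ ^ ((d : ℝ) + α)) := by
    intro x
    simp_rw [key x]
    rw [integral_const_mul]
    have := Measure.integral_comp_inv_smul (volume : Measure (EuclideanSpace ℝ (Fin d)))
      (fun y => (φ (t⁻¹ • x) - φ y) ^ 2 / ‖t⁻¹ • x - y‖ ^ ((d : ℝ) + α)) t
    rw [finrank_euclideanSpace_fin, abs_of_pos (by positivity), smul_eq_mul] at this
    rw [this]
  simp_rw [hin]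
  rw [integral_const_mul, integral_const_mul]
  have := Measure.integral_comp_inv_smul (volume : Measure (EuclideanSpace ℝ (Fin d)))
      (fun x => ∫ y, (φ x - φ y) ^ 2 / ‖x - y‖ ^ ((d : ℝ) + α)) t
  rw [finrank_euclideanSpace_fin, abs_of_pos (by positivity), smul_eq_mul] at this
  rw [this, Real.rpow_add ht, Real.rpow_natCast]
  have h1 : t ^ α ≠ 0 := (Real.rpow_pos_of_pos ht _).ne'
  field_simp

set_option maxHeartbeats 2000000 in
theorem no_super_poincare_of_small_weight
    (d : ℕ) (α : ℝ) (hα : α ∈ Set.Ioo (0 : ℝ) 2) (hd : α < d)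
    (W : EuclideanSpace ℝ (Fin d) → ℝ) (hWmeas : Measurable W)
    (hW1 : ∀ x, 1 ≤ W x)
    (hWsmall : ∃ M : ℝ, ∀ x : EuclideanSpace ℝ (Fin d), W x / (1 + ‖x‖) ^ α ≤ M) :
    ∀ β : ℝ → ℝ, (∀ r : ℝ, 0 < r → 0 < β r) →
      ¬ (∀ r : ℝ, 0 < r →
          ∀ f : EuclideanSpace ℝ (Fin d) → ℝ, ContDiff ℝ (⊤ : ℕ∞) f → HasCompactSupport f →
            ∫ x, (f x) ^ 2 * (W x)⁻¹ ≤
              r * fracD d α f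
                + β r * (∫ x, |f x| * Real.exp (-‖x‖) * (W x)⁻¹) ^ 2) := by
  intro β hβ H
  obtain ⟨M, hM⟩ := hWsmall
  have hα0 : 0 < α := hα.1
  have hM1 : 1 ≤ M := by
    have h := hM 0
    simp only [norm_zero, add_zero, Real.one_rpow, div_one] at h
    exact (hW1 0).trans h
  have hM0 : 0 < M := by linarith
  have hdpos : 0 < d := by
    have : (0 : ℝ) < d := hα0.trans hd
    exact_mod_cast this
  let c : EuclideanSpace ℝ (Fin d) := EuclideanSpace.single ⟨0, hdpos⟩ (3 : ℝ)
  have hc : ‖c‖ = 3 := by simp [c]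
  let b : ContDiffBump c := ⟨1, 2, by norm_num, by norm_num⟩
  let φ : EuclideanSpace ℝ (Fin d) → ℝ := fun x => b x
  have hφs : ContDiff ℝ (⊤ : ℕ∞) φ := b.contDiff
  have hφc : HasCompactSupport φ := b.hasCompactSupport
  have hφ0 : ∀ x, 0 ≤ φ x := fun x => b.nonneg
  have hφcont : Continuous φ := hφs.continuous
  have hφ1 : φ c = 1 := b.one_of_mem_closedBall (by simp [b])
  have hφfar : ∀ x, ‖x‖ ≤ 1 → φ x = 0 := by
    intro x hx
    apply b.zero_of_le_dist
    change (2 : ℝ) ≤ dist x c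
    rw [dist_eq_norm, norm_sub_rev]
    have := norm_sub_norm_le c x
    linarith
  clear_value φ c
  have hpos : ∀ x : EuclideanSpace ℝ (Fin d), 0 < (1 + ‖x‖) ^ α :=
    fun x => Real.rpow_pos_of_pos (by positivity) _
  let Hf : EuclideanSpace ℝ (Fin d) → ℝ := fun x => φ x ^ 2 * (M * (1 + ‖x‖) ^ α)⁻¹
  have hHfc : Continuous Hf := by
    refine (hφcont.pow 2).mul (Continuous.inv₀ (continuous_const.mul
      (Continuous.rpow_const (by fun_prop) (fun x => Or.inr hα0.le))) ?_)
    intro x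
    exact (mul_pos hM0 (hpos x)).ne'
  have hHfs : HasCompactSupport Hf := by
    apply HasCompactSupport.mul_right
    exact hφc.comp_left (g := fun y : ℝ => y ^ 2) (by simp)
  have hHpos : 0 < ∫ x, Hf x := by
    apply hHfc.integral_pos_of_hasCompactSupport_nonneg_nonzero hHfs (x := c)
    · intro x
      have := hpos x
      show 0 ≤ φ x ^ 2 * (M * (1 + ‖x‖) ^ α)⁻¹
      positivity
    · have := hpos c
      show φ c ^ 2 * (M * (1 + ‖c‖) ^ α)⁻¹ ≠ 0
      rw [hφ1]
      positivity
  obtain ⟨c0, hc0⟩ : ∃ z : ℝ, z = ∫ x, Hf x := ⟨_, rfl⟩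
  rw [← hc0] at hHpos
  obtain ⟨C, hC⟩ : ∃ z : ℝ, z = ∫ x, φ x := ⟨_, rfl⟩
  obtain ⟨D, hD⟩ : ∃ z : ℝ, z = fracD d α φ := ⟨_, rfl⟩
  obtain ⟨r, hrdef⟩ : ∃ r : ℝ, r = c0 / (2 * (|D| + 1)) := ⟨_, rfl⟩
  have hr : 0 < r := by rw [hrdef]; positivity
  have hrD : r * D ≤ c0 / 2 := by
    calc r * D ≤ r * (|D| + 1) := by
          apply mul_le_mul_of_nonneg_left _ hr.le
          linarith [le_abs_self D]
      _ = c0 / 2 := by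
          rw [hrdef]; field_simp
  have main : ∀ t : ℝ, 1 ≤ t → c0 / 2 ≤ β r * C ^ 2 * (t ^ ((d : ℝ) + α) * Real.exp (-2 * t)) := by
    intro t ht1
    have ht : 0 < t := by linarith
    let e : EuclideanSpace ℝ (Fin d) ≃ₜ EuclideanSpace ℝ (Fin d) :=
      Homeomorph.smulOfNeZero t⁻¹ (inv_ne_zero ht.ne')
    have hfs : ContDiff ℝ (⊤ : ℕ∞) (fun x => φ (t⁻¹ • x)) :=
      hφs.comp (contDiff_const_smul _)
    have hfc : HasCompactSupport (fun x => φ (t⁻¹ • x)) := hφc.comp_homeomorph e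
    have hHsc : HasCompactSupport (fun x => Hf (t⁻¹ • x)) := hHfs.comp_homeomorph e
    have h := H r hr _ hfs hfc
    rw [fracD_scale d α φ t ht, ← hD] at h
    have htα : 0 < t ^ α := Real.rpow_pos_of_pos ht _
    have hWpos : ∀ x, 0 < W x := fun x => by linarith [hW1 x]
    have hWinv : ∀ x, (W x)⁻¹ ≤ 1 := fun x => inv_le_one_of_one_le₀ (hW1 x)
    have sc : ∀ g : EuclideanSpace ℝ (Fin d) → ℝ, ∫ x, g (t⁻¹ • x) = t ^ d * ∫ x, g x := by
      intro g
      have := Measure.integral_comp_inv_smul (volume : Measure (EuclideanSpace ℝ (Fin d))) g t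
      rwa [finrank_euclideanSpace_fin, abs_of_pos (by positivity), smul_eq_mul] at this
    have lower : t ^ d * (t ^ α)⁻¹ * c0 ≤ ∫ x, (φ (t⁻¹ • x)) ^ 2 * (W x)⁻¹ := by
      have e1 : t ^ d * (t ^ α)⁻¹ * c0 = ∫ x, (t ^ α)⁻¹ * Hf (t⁻¹ • x) := by
        rw [integral_const_mul, sc, ← hc0]; ring
      rw [e1]
      apply integral_mono
      · apply Integrable.const_mul
        exact (hHfc.comp e.continuous).integrable_of_hasCompactSupport hHsc
      · have i1 : Integrable (fun x => (φ (t⁻¹ • x)) ^ 2) := by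
          apply (hfs.continuous.pow 2).integrable_of_hasCompactSupport
          exact hfc.comp_left (g := fun y : ℝ => y ^ 2) (by simp)
        refine i1.mono (i1.aestronglyMeasurable.mul hWmeas.inv.aestronglyMeasurable) ?_
        refine Filter.Eventually.of_forall fun x => ?_
        rw [norm_mul, Real.norm_of_nonneg (inv_nonneg.2 (hWpos x).le)]
        exact mul_le_of_le_one_right (norm_nonneg _) (hWinv x)
      · intro x
        show (t ^ α)⁻¹ * (φ (t⁻¹ • x) ^ 2 * (M * (1 + ‖t⁻¹ • x‖) ^ α)⁻¹) ≤ _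
        have hx : W x ≤ t ^ α * (M * (1 + ‖t⁻¹ • x‖) ^ α) := by
          have h1 := hM x
          rw [div_le_iff₀ (hpos x)] at h1
          refine h1.trans ?_
          have h2 : (1 + ‖x‖) ^ α ≤ (t * (1 + ‖t⁻¹ • x‖)) ^ α := by
            apply Real.rpow_le_rpow (by positivity) _ hα0.le
            rw [norm_smul, Real.norm_of_nonneg (by positivity : (0:ℝ) ≤ t⁻¹), mul_add,
              ← mul_assoc, mul_inv_cancel₀ ht.ne']
            linarith
          rw [Real.mul_rpow ht.le (by positivity)] at h2
          calc M * (1 + ‖x‖) ^ α ≤ M * (t ^ α * (1 + ‖t⁻¹ • x‖) ^ α) :=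
                mul_le_mul_of_nonneg_left h2 hM0.le
            _ = _ := by ring
        calc (t ^ α)⁻¹ * (φ (t⁻¹ • x) ^ 2 * (M * (1 + ‖t⁻¹ • x‖) ^ α)⁻¹)
            = φ (t⁻¹ • x) ^ 2 * (t ^ α * (M * (1 + ‖t⁻¹ • x‖) ^ α))⁻¹ := by
              rw [mul_inv (t ^ α)]; ring
          _ ≤ φ (t⁻¹ • x) ^ 2 * (W x)⁻¹ :=
              mul_le_mul_of_nonneg_left (inv_anti₀ (hWpos x) hx) (sq_nonneg _)
    have n0 : ∀ x, 0 ≤ |φ (t⁻¹ • x)| * Real.exp (-‖x‖) * (W x)⁻¹ := fun x => by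
      have := hWpos x
      positivity
    have upper : ∫ x, |φ (t⁻¹ • x)| * Real.exp (-‖x‖) * (W x)⁻¹ ≤ Real.exp (-t) * (t ^ d * C) := by
      rw [hC, ← sc φ, ← integral_const_mul]
      apply integral_mono_of_nonneg (Filter.Eventually.of_forall n0)
      · exact (hfs.continuous.integrable_of_hasCompactSupport hfc).const_mul _
      · refine Filter.Eventually.of_forall fun x => ?_
        show |φ (t⁻¹ • x)| * Real.exp (-‖x‖) * (W x)⁻¹ ≤ Real.exp (-t) * φ (t⁻¹ • x)
        rw [abs_of_nonneg (hφ0 _)]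
        by_cases hx : ‖t⁻¹ • x‖ ≤ 1
        · simp [hφfar _ hx]
        · have hx' : t ≤ ‖x‖ := by
            push Not at hx
            rw [norm_smul, Real.norm_of_nonneg (by positivity : (0:ℝ) ≤ t⁻¹),
              inv_mul_eq_div, lt_div_iff₀ ht] at hx
            linarith
          calc φ (t⁻¹ • x) * Real.exp (-‖x‖) * (W x)⁻¹
              ≤ φ (t⁻¹ • x) * Real.exp (-‖x‖) :=
                mul_le_of_le_one_right (mul_nonneg (hφ0 _) (Real.exp_pos _).le) (hWinv x)
            _ ≤ φ (t⁻¹ • x) * Real.exp (-t) :=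
                mul_le_mul_of_nonneg_left (Real.exp_le_exp.2 (by linarith)) (hφ0 _)
            _ = _ := mul_comm _ _
    have upper2 := pow_le_pow_left₀ (integral_nonneg n0) upper 2
    have h3 : t ^ d * (t ^ α)⁻¹ * c0 ≤ r * (t ^ d * (t ^ α)⁻¹ * D)
        + β r * (Real.exp (-t) * (t ^ d * C)) ^ 2 :=
      lower.trans (h.trans (add_le_add le_rfl (mul_le_mul_of_nonneg_left upper2 (hβ r hr).le)))
    have hA : 0 < t ^ d := by positivity
    have hE : Real.exp (-2 * t) = Real.exp (-t) ^ 2 := by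
      rw [← Real.exp_nat_mul]; congr 1; push_cast; ring
    rw [Real.rpow_add ht, Real.rpow_natCast, hE]
    have h4 : c0 ≤ r * D + β r * C ^ 2 * (t ^ d * t ^ α * Real.exp (-t) ^ 2) := by
      have hq : 0 < t ^ d * (t ^ α)⁻¹ := by positivity
      refine le_of_mul_le_mul_left (h3.trans (le_of_eq ?_)) hq
      field_simp
    linarith
  have lim := (tendsto_rpow_mul_exp_neg_mul_atTop_nhds_zero ((d : ℝ) + α) 2 (by norm_num)).const_mul
    (β r * C ^ 2)
  rw [mul_zero] at lim
  have hle : c0 / 2 ≤ 0 :=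
    ge_of_tendsto lim ((Filter.eventually_ge_atTop 1).mono main)
  linarith
end

section
/- Let α ∈ (0,2), d > α, β > α and c₀, c₁ > 0. Let W : ℝ^d → (0,∞) be measurable with W(x) ≥ c₀(1 + |x|)^β for all x, and let φ : ℝ^d → [0,∞) be measurable and bounded, satisfying φ(x) = c₁ ∫_{ℝ^d} φ(y) / ( W(y) |x − y|^{d−α} ) dy for all x ∈ ℝ^d. Then there exists a constant C > 0 such that for all x ∈ ℝ^d: φ(x) ≤ C·(1 + |x|)^{α−d}·( 1 + 1_{{ (d−β)/(β−α) ∈ ℤ₊ }}·log(2 + |x|) ), where ℤ₊ = {0, 1, 2, …}. -/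
open MeasureTheory

lemma gs_small (d : ℕ) (hd0 : 0 < d) (a : ℝ) (ha : a < d) :
    ∃ K : ℝ, 0 ≤ K ∧ ∀ R : ℝ, 0 < R →
      Integrable (fun y : EuclideanSpace ℝ (Fin d) =>
        (Set.Iic R).indicator (fun t : ℝ => t ^ (-a)) ‖y‖) ∧
      ∫ y : EuclideanSpace ℝ (Fin d),
        (Set.Iic R).indicator (fun t : ℝ => t ^ (-a)) ‖y‖ = K * R ^ ((d : ℝ) - a) := by
  haveI : Nonempty (Fin d) := ⟨⟨0, hd0⟩⟩
  refine ⟨d * (volume.real (Metric.ball (0 : EuclideanSpace ℝ (Fin d)) 1) * (1 / ((d : ℝ) - a))),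
    ?_, ?_⟩
  · have : 0 < (d : ℝ) - a := by linarith
    positivity
  intro R hR
  have key : Set.EqOn (fun y : ℝ => y ^ (d - 1) • (Set.Iic R).indicator (fun t : ℝ => t ^ (-a)) y)
      ((Set.Iic R).indicator (fun t : ℝ => t ^ ((d : ℝ) - 1 - a))) (Set.Ioi 0) := by
    intro y hy
    have hy : 0 < y := hy
    by_cases h : y ∈ Set.Iic R
    · simp only [Set.indicator_of_mem h, smul_eq_mul]
      rw [← Real.rpow_natCast, ← Real.rpow_add hy]
      congr 1
      rw [Nat.cast_sub hd0]; push_cast; ring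
    · simp [Set.indicator_of_notMem h]
  have hset : Set.Ioi (0 : ℝ) ∩ Set.Iic R = Set.Ioc 0 R := Set.Ioi_inter_Iic
  have hint : IntegrableOn (fun t : ℝ => t ^ ((d : ℝ) - 1 - a)) (Set.Ioc 0 R) := by
    have := intervalIntegral.intervalIntegrable_rpow' (a := 0) (b := R)
      (r := (d : ℝ) - 1 - a) (by linarith)
    exact (intervalIntegrable_iff_integrableOn_Ioc_of_le hR.le).1 this
  constructor
  · rw [integrable_fun_norm_addHaar volume
      (f := (Set.Iic R).indicator (fun t : ℝ => t ^ (-a))), finrank_euclideanSpace_fin,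
      integrableOn_congr_fun key measurableSet_Ioi, IntegrableOn,
      integrable_indicator_iff measurableSet_Iic, IntegrableOn,
      Measure.restrict_restrict measurableSet_Iic, Set.inter_comm, hset]
    exact hint
  · rw [integral_fun_norm_addHaar volume ((Set.Iic R).indicator (fun t : ℝ => t ^ (-a))),
      finrank_euclideanSpace_fin, setIntegral_congr_fun measurableSet_Ioi key,
      setIntegral_indicator measurableSet_Iic, hset,
      ← intervalIntegral.integral_of_le hR.le, integral_rpow (Or.inl (by linarith)),
      Real.zero_rpow (by linarith)]
    simp only [nsmul_eq_mul, smul_eq_mul]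
    rw [show (d : ℝ) - 1 - a + 1 = d - a by ring]
    ring

lemma gs_large (d : ℕ) (hd0 : 0 < d) (a : ℝ) (ha : d < a) :
    ∃ K : ℝ, 0 ≤ K ∧ ∀ R : ℝ, 0 < R →
      Integrable (fun y : EuclideanSpace ℝ (Fin d) =>
        (Set.Ioi R).indicator (fun t : ℝ => t ^ (-a)) ‖y‖) ∧
      ∫ y : EuclideanSpace ℝ (Fin d),
        (Set.Ioi R).indicator (fun t : ℝ => t ^ (-a)) ‖y‖ = K * R ^ ((d : ℝ) - a) := by
  haveI : Nonempty (Fin d) := ⟨⟨0, hd0⟩⟩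
  refine ⟨d * (volume.real (Metric.ball (0 : EuclideanSpace ℝ (Fin d)) 1) * (1 / (a - (d : ℝ)))),
    ?_, ?_⟩
  · have : 0 < a - (d : ℝ) := by linarith
    positivity
  intro R hR
  have key : Set.EqOn (fun y : ℝ => y ^ (d - 1) • (Set.Ioi R).indicator (fun t : ℝ => t ^ (-a)) y)
      ((Set.Ioi R).indicator (fun t : ℝ => t ^ ((d : ℝ) - 1 - a))) (Set.Ioi 0) := by
    intro y hy
    have hy : 0 < y := hy
    by_cases h : y ∈ Set.Ioi R
    · simp only [Set.indicator_of_mem h, smul_eq_mul]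
      rw [← Real.rpow_natCast, ← Real.rpow_add hy]
      congr 1
      rw [Nat.cast_sub hd0]; push_cast; ring
    · simp [Set.indicator_of_notMem h]
  have hset : Set.Ioi (0 : ℝ) ∩ Set.Ioi R = Set.Ioi R := by
    rw [Set.Ioi_inter_Ioi, max_eq_right hR.le]
  have hint : IntegrableOn (fun t : ℝ => t ^ ((d : ℝ) - 1 - a)) (Set.Ioi R) :=
    integrableOn_Ioi_rpow_of_lt (by linarith) hR
  constructor
  · rw [integrable_fun_norm_addHaar volume
      (f := (Set.Ioi R).indicator (fun t : ℝ => t ^ (-a))), finrank_euclideanSpace_fin,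
      integrableOn_congr_fun key measurableSet_Ioi, IntegrableOn,
      integrable_indicator_iff measurableSet_Ioi, IntegrableOn,
      Measure.restrict_restrict measurableSet_Ioi, Set.inter_comm, hset]
    exact hint
  · rw [integral_fun_norm_addHaar volume ((Set.Ioi R).indicator (fun t : ℝ => t ^ (-a))),
      finrank_euclideanSpace_fin, setIntegral_congr_fun measurableSet_Ioi key,
      setIntegral_indicator measurableSet_Ioi, hset,
      integral_Ioi_rpow_of_lt (by linarith) hR]
    simp only [nsmul_eq_mul, smul_eq_mul]
    rw [show (d : ℝ) - 1 - a + 1 = -(a - d) by ring, neg_div_neg_eq,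
      show (d : ℝ) - a = -(a - d) by ring]
    ring

/-- Kernel bound with weight exponent `s` and resulting decay exponent `t`. -/
def GSKern (d : ℕ) (α s t : ℝ) : Prop :=
  ∃ K : ℝ, 0 ≤ K ∧ ∀ x : EuclideanSpace ℝ (Fin d), 2 ≤ ‖x‖ →
    ∃ g : EuclideanSpace ℝ (Fin d) → ℝ, Integrable g ∧
      (∀ᵐ y, (1 + ‖y‖) ^ (-s) * ‖x - y‖ ^ (-((d : ℝ) - α)) ≤ g y) ∧
      ∫ y, g y ≤ K * (‖x‖ / 2) ^ (-t)

lemma gs_rpow_anti {u v p : ℝ} (hu : 0 < u) (huv : u ≤ v) (hp : 0 ≤ p) : v ^ (-p) ≤ u ^ (-p) :=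
  Real.rpow_le_rpow_of_nonpos hu huv (by linarith)

lemma gs_kern_big (d : ℕ) (α s : ℝ) (hα : 0 < α) (hd : α < d) (hs : d < s) :
    GSKern d α s (d - α) := by
  have hd0 : 0 < d := by
    have : (0 : ℝ) < d := by linarith
    exact_mod_cast this
  obtain ⟨K, hK, hKR⟩ := gs_small d hd0 ((d : ℝ) - α) (by linarith)
  have hI : Integrable (fun y : EuclideanSpace ℝ (Fin d) => (1 + ‖y‖) ^ (-s)) :=
    integrable_one_add_norm (by rw [finrank_euclideanSpace_fin]; exact hs)
  have hI0 : 0 ≤ ∫ y : EuclideanSpace ℝ (Fin d), (1 + ‖y‖) ^ (-s) :=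
    integral_nonneg fun y => by positivity
  refine ⟨K + ∫ y : EuclideanSpace ℝ (Fin d), (1 + ‖y‖) ^ (-s), by positivity, ?_⟩
  intro x hx
  obtain ⟨r, hr⟩ : ∃ r, r = ‖x‖ / 2 := ⟨_, rfl⟩
  rw [← hr]
  have hr1 : 1 ≤ r := by linarith
  have hr0 : 0 < r := by linarith
  obtain ⟨h1, h2⟩ := hKR r hr0
  refine ⟨fun y => r ^ (-s) * (Set.Iic r).indicator (fun t : ℝ => t ^ (-((d : ℝ) - α))) ‖x - y‖ +
    r ^ (-((d : ℝ) - α)) * (1 + ‖y‖) ^ (-s), ?_, ?_, ?_⟩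
  · exact ((h1.comp_sub_left x).const_mul _).add (hI.const_mul _)
  · refine Filter.Eventually.of_forall fun y => ?_
    by_cases h : ‖x - y‖ ∈ Set.Iic r
    · have h' : ‖x - y‖ ≤ r := h
      simp only [Set.indicator_of_mem h]
      have hy : r ≤ 1 + ‖y‖ := by
        have := norm_sub_norm_le x y
        linarith
      have := gs_rpow_anti hr0 hy (p := s) (by linarith)
      have h3 : 0 ≤ r ^ (-((d : ℝ) - α)) * (1 + ‖y‖) ^ (-s) := by positivity
      have := mul_le_mul_of_nonneg_right this
        (show 0 ≤ ‖x - y‖ ^ (-((d : ℝ) - α)) by positivity)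
      linarith
    · have h' : r < ‖x - y‖ := not_le.1 h
      simp only [Set.indicator_of_notMem h, mul_zero, zero_add]
      rw [mul_comm]
      exact mul_le_mul_of_nonneg_right (gs_rpow_anti hr0 h'.le (by linarith)) (by positivity)
  · rw [integral_add ((h1.comp_sub_left x).const_mul _) (hI.const_mul _), integral_const_mul,
      integral_const_mul, integral_sub_left_eq_self
        (fun y : EuclideanSpace ℝ (Fin d) =>
          (Set.Iic r).indicator (fun t : ℝ => t ^ (-((d : ℝ) - α))) ‖y‖) volume x, h2]
    have : r ^ (-s) * r ^ ((d : ℝ) - (d - α)) ≤ r ^ (-((d : ℝ) - α)) := by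
      rw [← Real.rpow_add hr0]
      exact Real.rpow_le_rpow_of_exponent_le hr1 (by linarith)
    have := mul_le_mul_of_nonneg_left this hK
    nlinarith

lemma gs_kern_small (d : ℕ) (α s : ℝ) (hα : 0 < α) (hd : α < d) (hs : α < s) (hsd : s < d) :
    GSKern d α s (s - α) := by
  have hd0 : 0 < d := by
    have : (0 : ℝ) < d := by linarith
    exact_mod_cast this
  haveI : Nonempty (Fin d) := ⟨⟨0, hd0⟩⟩
  obtain ⟨K, hK, hKR⟩ := gs_small d hd0 ((d : ℝ) - α) (by linarith)
  obtain ⟨L, hL, hLR⟩ := gs_small d hd0 s hsd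
  obtain ⟨N, hN, hNR⟩ := gs_large d hd0 (s + (d - α)) (by linarith)
  refine ⟨K + L * 4 ^ ((d : ℝ) - s) + 2 ^ ((d : ℝ) - α) * N * 4 ^ (α - s), by positivity, ?_⟩
  intro x hx
  obtain ⟨r, hr⟩ : ∃ r, r = ‖x‖ / 2 := ⟨_, rfl⟩
  rw [← hr]
  have hr1 : 1 ≤ r := by linarith
  have hr0 : 0 < r := by linarith
  obtain ⟨h1, h2⟩ := hKR r hr0
  obtain ⟨h3, h4⟩ := hLR (4 * r) (by linarith)
  obtain ⟨h5, h6⟩ := hNR (4 * r) (by linarith)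
  have i1 := (h1.comp_sub_left x).const_mul (r ^ (-s))
  have i2 := h3.const_mul (r ^ (-((d : ℝ) - α)))
  have i3 := h5.const_mul (2 ^ ((d : ℝ) - α))
  refine ⟨_, (i1.add i2).add i3, ?_, ?_⟩
  · filter_upwards [Measure.ae_ne volume (0 : EuclideanSpace ℝ (Fin d))] with y hy0
    have hy : 0 < ‖y‖ := norm_pos_iff.2 hy0
    simp only [Pi.add_apply]
    have n1 : 0 ≤ r ^ (-s) *
        (Set.Iic r).indicator (fun t : ℝ => t ^ (-((d : ℝ) - α))) ‖x - y‖ := by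
      refine mul_nonneg (by positivity) ?_
      rw [Set.indicator_apply]; split_ifs <;> positivity
    have n2 : 0 ≤ r ^ (-((d : ℝ) - α)) *
        (Set.Iic (4 * r)).indicator (fun t : ℝ => t ^ (-s)) ‖y‖ := by
      refine mul_nonneg (by positivity) ?_
      rw [Set.indicator_apply]; split_ifs <;> positivity
    have n3 : 0 ≤ (2 : ℝ) ^ ((d : ℝ) - α) *
        (Set.Ioi (4 * r)).indicator (fun t : ℝ => t ^ (-(s + ((d : ℝ) - α)))) ‖y‖ := by
      refine mul_nonneg (by positivity) ?_
      rw [Set.indicator_apply]; split_ifs <;> positivity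
    have q0 : (1 + ‖y‖) ^ (-s) ≤ ‖y‖ ^ (-s) := gs_rpow_anti hy (by linarith) (by linarith)
    by_cases h : ‖x - y‖ ∈ Set.Iic r
    · have h' : ‖x - y‖ ≤ r := h
      simp only [Set.indicator_of_mem h] at n1 ⊢
      have hy : r ≤ 1 + ‖y‖ := by
        have := norm_sub_norm_le x y
        linarith
      have := gs_rpow_anti hr0 hy (p := s) (by linarith)
      have := mul_le_mul_of_nonneg_right this
        (show 0 ≤ ‖x - y‖ ^ (-((d : ℝ) - α)) by positivity)
      linarith
    · have h' : r < ‖x - y‖ := not_le.1 h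
      by_cases hA : ‖y‖ ∈ Set.Iic (4 * r)
      · simp only [Set.indicator_of_mem hA] at n2 ⊢
        have : (1 + ‖y‖) ^ (-s) * ‖x - y‖ ^ (-((d : ℝ) - α)) ≤
            ‖y‖ ^ (-s) * r ^ (-((d : ℝ) - α)) :=
          mul_le_mul q0 (gs_rpow_anti hr0 h'.le (by linarith)) (by positivity) (by positivity)
        linarith
      · have hC' : 4 * r < ‖y‖ := not_le.1 hA
        have hC : ‖y‖ ∈ Set.Ioi (4 * r) := hC'
        simp only [Set.indicator_of_mem hC] at n3 ⊢
        have h7 : ‖y‖ / 2 ≤ ‖x - y‖ := by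
          have := norm_sub_norm_le y x
          rw [norm_sub_rev] at this
          linarith
        have : (1 + ‖y‖) ^ (-s) * ‖x - y‖ ^ (-((d : ℝ) - α)) ≤
            ‖y‖ ^ (-s) * (‖y‖ / 2) ^ (-((d : ℝ) - α)) :=
          mul_le_mul q0 (gs_rpow_anti (by linarith) h7 (by linarith)) (by positivity)
            (by positivity)
        have e : ‖y‖ ^ (-s) * (‖y‖ / 2) ^ (-((d : ℝ) - α)) =
            2 ^ ((d : ℝ) - α) * ‖y‖ ^ (-(s + ((d : ℝ) - α))) := by
          rw [Real.div_rpow hy.le (by norm_num), neg_add, Real.rpow_add hy,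
            Real.rpow_neg (by norm_num : (0 : ℝ) ≤ 2), div_inv_eq_mul]
          ring
        linarith
  · rw [integral_add' (i1.add i2) i3, integral_add' i1 i2, integral_const_mul,
      integral_const_mul, integral_const_mul, integral_sub_left_eq_self
        (fun y : EuclideanSpace ℝ (Fin d) =>
          (Set.Iic r).indicator (fun t : ℝ => t ^ (-((d : ℝ) - α))) ‖y‖) volume x, h2, h4, h6]
    have e1 : r ^ (-s) * r ^ ((d : ℝ) - (d - α)) = r ^ (-(s - α)) := by
      rw [← Real.rpow_add hr0]; congr 1; ring
    have e2 : r ^ (-((d : ℝ) - α)) * (4 * r) ^ ((d : ℝ) - s) =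
        4 ^ ((d : ℝ) - s) * r ^ (-(s - α)) := by
      rw [Real.mul_rpow (by norm_num) hr0.le, mul_left_comm, ← Real.rpow_add hr0]
      congr 2; ring
    have e3 : (4 * r) ^ ((d : ℝ) - (s + (d - α))) = 4 ^ (α - s) * r ^ (-(s - α)) := by
      rw [Real.mul_rpow (by norm_num) hr0.le]
      congr 2 <;> ring
    rw [e3]
    apply le_of_eq
    calc _ = K * (r ^ (-s) * r ^ ((d : ℝ) - (d - α))) +
          L * (r ^ (-((d : ℝ) - α)) * (4 * r) ^ ((d : ℝ) - s)) +
          2 ^ ((d : ℝ) - α) * (N * (4 ^ (α - s) * r ^ (-(s - α)))) := by ring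
      _ = _ := by rw [e1, e2]; ring

lemma gs_step (d : ℕ) (α β : ℝ) 
    (c₀ c₁ : ℝ) (hc₀ : 0 < c₀) (hc₁ : 0 < c₁)
    (W : EuclideanSpace ℝ (Fin d) → ℝ)
    (hWlb : ∀ x : EuclideanSpace ℝ (Fin d), c₀ * (1 + ‖x‖) ^ β ≤ W x)
    (φ : EuclideanSpace ℝ (Fin d) → ℝ) (hφnonneg : ∀ x, 0 ≤ φ x)
    (hφbdd : ∃ M : ℝ, ∀ x, φ x ≤ M)
    (hrep : ∀ x : EuclideanSpace ℝ (Fin d),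
      φ x = c₁ * ∫ y, φ y / (W y * ‖x - y‖ ^ ((d : ℝ) - α)))
    (γ s t : ℝ) (ht : 0 ≤ t) (hs : s ≤ γ + β) (hk : GSKern d α s t)
    (hP : ∃ C : ℝ, 0 < C ∧ ∀ x, φ x ≤ C * (1 + ‖x‖) ^ (-γ)) :
    ∃ C : ℝ, 0 < C ∧ ∀ x, φ x ≤ C * (1 + ‖x‖) ^ (-t) := by
  obtain ⟨M, hM⟩ := hφbdd
  obtain ⟨C, hC, hCx⟩ := hP
  obtain ⟨K, hK, hKx⟩ := hk
  have hM0 : 0 ≤ M := (hφnonneg 0).trans (hM 0)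
  refine ⟨M * 3 ^ t + c₁ * (C / c₀) * K * 4 ^ t + 1, by positivity, fun x => ?_⟩
  have hp : 0 < (1 + ‖x‖) ^ (-t) := by positivity
  have conv : ∀ b : ℝ, 0 < b → 1 = b ^ t * b ^ (-t) := by
    intro b hb
    rw [← Real.rpow_add hb]; simp
  by_cases hx : 2 ≤ ‖x‖
  · obtain ⟨g, hg, hgle, hgI⟩ := hKx x hx
    have h1 : ∫ y, φ y / (W y * ‖x - y‖ ^ ((d : ℝ) - α)) ≤ ∫ y, (C / c₀) * g y := by
      refine integral_mono_of_nonneg (Filter.Eventually.of_forall fun y => ?_)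
        (hg.const_mul _) ?_
      · have : 0 ≤ W y := le_trans (by positivity) (hWlb y)
        have := hφnonneg y
        simp only [Pi.zero_apply]
        positivity
      · filter_upwards [hgle] with y hy
        have hWp : 0 < c₀ * (1 + ‖y‖) ^ β := by positivity
        have h2 : φ y / W y ≤ (C / c₀) * (1 + ‖y‖) ^ (-s) := by
          calc φ y / W y ≤ (C * (1 + ‖y‖) ^ (-γ)) / (c₀ * (1 + ‖y‖) ^ β) :=
                div_le_div₀ (by positivity) (hCx y) hWp (hWlb y)
            _ = (C / c₀) * (1 + ‖y‖) ^ (-(γ + β)) := by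
                rw [neg_add, Real.rpow_add (by positivity), Real.rpow_neg (by positivity) β]
                field_simp
            _ ≤ _ := by
                refine mul_le_mul_of_nonneg_left ?_ (by positivity)
                exact Real.rpow_le_rpow_of_exponent_le (by linarith [norm_nonneg y])
                  (by linarith)
        calc φ y / (W y * ‖x - y‖ ^ ((d : ℝ) - α))
            = φ y / W y * ‖x - y‖ ^ (-((d : ℝ) - α)) := by
              rw [Real.rpow_neg (norm_nonneg _), ← div_div, div_eq_mul_inv (φ y / W y)]
          _ ≤ (C / c₀) * (1 + ‖y‖) ^ (-s) * ‖x - y‖ ^ (-((d : ℝ) - α)) :=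
              mul_le_mul_of_nonneg_right h2 (by positivity)
          _ = (C / c₀) * ((1 + ‖y‖) ^ (-s) * ‖x - y‖ ^ (-((d : ℝ) - α))) := by ring
          _ ≤ _ := mul_le_mul_of_nonneg_left hy (by positivity)
    rw [integral_const_mul] at h1
    have h3 : (‖x‖ / 2) ^ (-t) ≤ 4 ^ t * (1 + ‖x‖) ^ (-t) := by
      calc (‖x‖ / 2) ^ (-t) ≤ ((1 + ‖x‖) / 4) ^ (-t) :=
            gs_rpow_anti (by positivity) (by linarith) ht
        _ = _ := by
          rw [Real.div_rpow (by positivity) (by norm_num),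
            Real.rpow_neg (by norm_num : (0 : ℝ) ≤ 4), div_inv_eq_mul, mul_comm]
    rw [hrep x]
    have h4 : c₁ * ∫ y, φ y / (W y * ‖x - y‖ ^ ((d : ℝ) - α)) ≤
        c₁ * ((C / c₀) * (K * (4 ^ t * (1 + ‖x‖) ^ (-t)))) := by
      refine mul_le_mul_of_nonneg_left (h1.trans ?_) hc₁.le
      refine mul_le_mul_of_nonneg_left (hgI.trans ?_) (by positivity)
      exact mul_le_mul_of_nonneg_left h3 hK
    have h5 : 0 ≤ M * 3 ^ t * (1 + ‖x‖) ^ (-t) := by positivity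
    linarith
  · have h3 : (3 : ℝ) ^ (-t) ≤ (1 + ‖x‖) ^ (-t) :=
      gs_rpow_anti (by positivity) (by linarith) ht
    have h4 : M ≤ M * 3 ^ t * (1 + ‖x‖) ^ (-t) := by
      calc M = M * 3 ^ t * 3 ^ (-t) := by rw [mul_assoc, ← conv 3 (by norm_num), mul_one]
        _ ≤ _ := mul_le_mul_of_nonneg_left h3 (by positivity)
    have h5 : 0 ≤ c₁ * (C / c₀) * K * 4 ^ t * (1 + ‖x‖) ^ (-t) := by positivity
    have := hM x
    linarith

open Classical in
theorem ground_state_upper_bound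
    (d : ℕ) (α β : ℝ) (hα : α ∈ Set.Ioo (0 : ℝ) 2) (hd : α < d) (hβ : α < β)
    (c₀ c₁ : ℝ) (hc₀ : 0 < c₀) (hc₁ : 0 < c₁)
    (W : EuclideanSpace ℝ (Fin d) → ℝ) (hWmeas : Measurable W)
    (hWlb : ∀ x : EuclideanSpace ℝ (Fin d), c₀ * (1 + ‖x‖) ^ β ≤ W x)
    (φ : EuclideanSpace ℝ (Fin d) → ℝ) (hφmeas : Measurable φ) (hφnonneg : ∀ x, 0 ≤ φ x)
    (hφbdd : ∃ M : ℝ, ∀ x, φ x ≤ M)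
    -- Green-function representation of the eigenfunction
    (hrep : ∀ x : EuclideanSpace ℝ (Fin d),
      φ x = c₁ * ∫ y, φ y / (W y * ‖x - y‖ ^ ((d : ℝ) - α))) :
    ∃ C > (0 : ℝ), ∀ x : EuclideanSpace ℝ (Fin d),
      φ x ≤ C * (1 + ‖x‖) ^ (α - (d : ℝ)) *
        (1 + (if ∃ k : ℕ, ((d : ℝ) - β) / (β - α) = (k : ℝ) then (1 : ℝ) else 0) *
          Real.log (2 + ‖x‖)) := by
  obtain ⟨hα0, hα2⟩ := hα
  have step := gs_step d α β c₀ c₁ hc₀ hc₁ W hWlb φ hφnonneg hφbdd hrep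
  obtain ⟨T, hT⟩ : ∃ T, T = max ((d : ℝ) - α - (β - α) / 2) ((d - α) / 2) := ⟨_, rfl⟩
  have hT1 : (d : ℝ) - α - (β - α) / 2 ≤ T := hT ▸ le_max_left _ _
  have hT2 : ((d : ℝ) - α) / 2 ≤ T := hT ▸ le_max_right _ _
  have hT3 : T < d - α := by rw [hT]; exact max_lt (by linarith) (by linarith)
  have hT0 : 0 < T := by linarith
  have iter : ∀ n : ℕ, ∃ C : ℝ, 0 < C ∧
      ∀ x, φ x ≤ C * (1 + ‖x‖) ^ (-(min (n * (β - α)) T)) := by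
    intro n
    induction n with
    | zero =>
      obtain ⟨M, hM⟩ := hφbdd
      refine ⟨M + 1, by linarith [hφnonneg 0, hM 0], fun x => ?_⟩
      simp only [Nat.cast_zero, zero_mul, min_eq_left hT0.le, neg_zero, Real.rpow_zero, mul_one]
      linarith [hM x]
    | succ n ih =>
      have hpos : 0 < min (((n + 1 : ℕ) : ℝ) * (β - α)) T := by
        refine lt_min (mul_pos (by positivity) (by linarith)) hT0
      have hle : min (((n + 1 : ℕ) : ℝ) * (β - α)) T ≤ T := min_le_right _ _
      have hstep : min (((n + 1 : ℕ) : ℝ) * (β - α)) T ≤ min (n * (β - α)) T + (β - α) := by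
        rw [← min_add_add_right]
        refine min_le_min (le_of_eq (by push_cast; ring)) (by linarith)
      have hk := gs_kern_small d α (min (((n + 1 : ℕ) : ℝ) * (β - α)) T + α) hα0 hd
        (by linarith) (by linarith)
      rw [add_sub_cancel_right] at hk
      exact step _ _ _ hpos.le (by linarith) hk ih
  obtain ⟨n, hn⟩ := exists_nat_ge (T / (β - α))
  have hn' : T ≤ n * (β - α) := (div_le_iff₀ (by linarith)).1 hn
  have hPT := iter n
  rw [min_eq_right hn'] at hPT
  obtain ⟨C, hC, hCx⟩ := step T (T + β) (d - α) (by linarith) le_rfl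
    (gs_kern_big d α (T + β) hα0 hd (by linarith)) hPT
  refine ⟨C, hC, fun x => (hCx x).trans ?_⟩
  rw [neg_sub]
  refine le_mul_of_one_le_right (by positivity) ?_
  have hlog : 0 ≤ Real.log (2 + ‖x‖) := Real.log_nonneg (by linarith [norm_nonneg x])
  split_ifs <;> linarith
end
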